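/- arXiv:1912.05214 — 4 statements merged into one kernel-verified Lean document; each statement's English description precedes it below -/
import Mathlib

section
/- Lattice closure lemma: Let F_X, F_Y be fixed univariate margins and let 𝒮 be a nonempty subset of 𝔔^{F_X,F_Y}. Then the pointwise infimum inf_{F∈𝒮} F and the pointwise supremum sup_{F∈𝒮} F again belong to 𝔔^{F_X,F_Y}. In particular, the pointwise infimum and supremum of any nonempty set of bivariate distributions with fixed margins F_X, F_Y are bivariate quasi-distributions with margins F_X, F_Y. -/
open scoped Classical

noncomputable section

/-- The `F`-volume of the rectangle `[a₁,a₂] × [b₁,b₂]`. -/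
def vol (F : EReal × EReal → ℝ) (a₁ a₂ b₁ b₂ : EReal) : ℝ :=
  F (a₂, b₂) - F (a₁, b₂) - F (a₂, b₁) + F (a₁, b₁)

/-- `x ∈ R̄` is an infinite value, i.e. `−∞` or `+∞`. -/
def IsInfinite (x : EReal) : Prop := x = ⊥ ∨ x = ⊤

/-- A bivariate quasi-distribution on `R̄²`. -/
def IsQuasiDist (F : EReal × EReal → ℝ) : Prop :=
  (∀ p : EReal × EReal, F p ∈ Set.Icc (0:ℝ) 1) ∧
  (∀ x : EReal, F (x, ⊥) = 0) ∧ (∀ y : EReal, F (⊥, y) = 0) ∧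
  F (⊤, ⊤) = 1 ∧
  (∀ a₁ a₂ b₁ b₂ : EReal, a₁ ≤ a₂ → b₁ ≤ b₂ →
    (IsInfinite a₁ ∨ IsInfinite a₂ ∨ IsInfinite b₁ ∨ IsInfinite b₂) →
    0 ≤ vol F a₁ a₂ b₁ b₂)

/-- A bivariate distribution on `R̄²` (no right-continuity assumed). -/
def IsDist (F : EReal × EReal → ℝ) : Prop :=
  (∀ p : EReal × EReal, F p ∈ Set.Icc (0:ℝ) 1) ∧
  (∀ x : EReal, F (x, ⊥) = 0) ∧ (∀ y : EReal, F (⊥, y) = 0) ∧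
  F (⊤, ⊤) = 1 ∧
  (∀ a₁ a₂ b₁ b₂ : EReal, a₁ ≤ a₂ → b₁ ≤ b₂ → 0 ≤ vol F a₁ a₂ b₁ b₂)

/-- `F` has margins `FX` and `FY`. -/
def HasMargins (F : EReal × EReal → ℝ) (FX FY : EReal → ℝ) : Prop :=
  (∀ x, F (x, ⊤) = FX x) ∧ (∀ y, F (⊤, y) = FY y)

/-- A univariate distribution function on `R̄` (no right-continuity assumed). -/
def UnivDist (F : EReal → ℝ) : Prop :=
  Monotone F ∧ F ⊥ = 0 ∧ F ⊤ = 1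

/-- A (nondegenerate) rectangle in `R̄²` with distinct standard corners. -/
structure Rect where
  x1 : EReal
  y1 : EReal
  x2 : EReal
  y2 : EReal
  hx : x1 < x2
  hy : y1 < y2

/-- The multiplicity of a point with respect to a rectangle: `+1` at the main
corners (southwest and northeast), `−1` at the opposite corners. -/
def Rect.mult (R : Rect) (p : EReal × EReal) : ℤ :=
  (if p = (R.x1, R.y1) then 1 else 0) + (if p = (R.x2, R.y2) then 1 else 0)
    - (if p = (R.x2, R.y1) then 1 else 0) - (if p = (R.x1, R.y2) then 1 else 0)

/-- The interior of a rectangle, as a subset of `R̄²`. -/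
def Rect.inter (R : Rect) : Set (EReal × EReal) :=
  Set.Ioo R.x1 R.x2 ×ˢ Set.Ioo R.y1 R.y2

/-- The image of a rectangle under the reflection `δ(x,y) = (−x,y)`. -/
def Rect.reflect (R : Rect) : Rect where
  x1 := -R.x2
  y1 := R.y1
  x2 := -R.x1
  y2 := R.y2
  hx := EReal.neg_lt_neg_iff.mpr R.hx
  hy := R.hy

/-- A finite (formal) union of rectangles is represented by a list; membership in `ℜ`
additionally requires pairwise disjointness, see `disjU`. -/
def disjU (U : List Rect) : Prop :=
  U.Pairwise fun R S => Disjoint R.inter S.inter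

/-- The multiplicity of a point with respect to a finite union of rectangles. -/
def multU (U : List Rect) (p : EReal × EReal) : ℤ :=
  (U.map fun R => R.mult p).sum

/-- The corners of a rectangle, as a list. -/
def Rect.cornerList (R : Rect) : List (EReal × EReal) :=
  [(R.x1, R.y1), (R.x2, R.y2), (R.x2, R.y1), (R.x1, R.y2)]

/-- The set of corners of a finite union of rectangles. -/
def cornersU (U : List Rect) : Finset (EReal × EReal) :=
  (U.flatMap Rect.cornerList).toFinset

/-- `L^{(A,B)}(R) = Σ_{m_R(y)>0} B(y)·m_R(y) + Σ_{m_R(y)<0} A(y)·m_R(y)`. -/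
def Lval (A B : EReal × EReal → ℝ) (U : List Rect) : ℝ :=
  ∑ p ∈ cornersU U,
    (if 0 < multU U p then B p * (multU U p : ℝ)
     else if multU U p < 0 then A p * (multU U p : ℝ) else 0)

/-- Condition (Q1): `A ≤ B` pointwise. -/
def CondQ1 (A B : EReal × EReal → ℝ) : Prop := ∀ p, A p ≤ B p

/-- Condition (Q2): `L^{(A,B)}(R) ≥ 0` for all `R ∈ ℜ`. -/
def CondQ2 (A B : EReal × EReal → ℝ) : Prop :=
  ∀ U : List Rect, disjU U → 0 ≤ Lval A B U

/-- `P_O^{(A,B)}(x) = inf { L^{(A,B)}(R)/(−m_R(x)) : R ∈ ℜ, m_R(x) < 0 }`,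
with the infimum of the empty set being `+∞`. -/
def PO (A B : EReal × EReal → ℝ) (x : EReal × EReal) : EReal :=
  ⨅ U : {U : List Rect // disjU U ∧ multU U x < 0},
    ((Lval A B U.1 / (-(multU U.1 x) : ℝ) : ℝ) : EReal)

/-- `P_M^{(A,B)}(x) = inf { L^{(A,B)}(R)/m_R(x) : R ∈ ℜ, m_R(x) > 0 }`,
with the infimum of the empty set being `+∞`. -/
def PM (A B : EReal × EReal → ℝ) (x : EReal × EReal) : EReal :=
  ⨅ U : {U : List Rect // disjU U ∧ 0 < multU U x},
    ((Lval A B U.1 / ((multU U.1 x) : ℝ) : ℝ) : EReal)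

/-- `γ^{(A,B)}(x) = min { P_O^{(A,B)}(x), B(x) − A(x) }`. -/
def gammaAB (A B : EReal × EReal → ℝ) (x : EReal × EReal) : EReal :=
  min (PO A B x) ((B x - A x : ℝ) : EReal)

/-- A quasi-copula on `[0,1]²`. -/
def IsQuasiCopula (Q : ℝ → ℝ → ℝ) : Prop :=
  (∀ u ∈ Set.Icc (0:ℝ) 1, ∀ v ∈ Set.Icc (0:ℝ) 1, Q u v ∈ Set.Icc (0:ℝ) 1) ∧
  (∀ u ∈ Set.Icc (0:ℝ) 1, Q u 0 = 0 ∧ Q 0 u = 0 ∧ Q u 1 = u ∧ Q 1 u = u) ∧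
  (∀ u ∈ Set.Icc (0:ℝ) 1, ∀ u' ∈ Set.Icc (0:ℝ) 1, ∀ v ∈ Set.Icc (0:ℝ) 1,
    u ≤ u' → Q u v ≤ Q u' v ∧ Q v u ≤ Q v u') ∧
  (∀ u ∈ Set.Icc (0:ℝ) 1, ∀ u' ∈ Set.Icc (0:ℝ) 1, ∀ v ∈ Set.Icc (0:ℝ) 1,
    ∀ v' ∈ Set.Icc (0:ℝ) 1, |Q u v - Q u' v'| ≤ |u - u'| + |v - v'|)

/-- A copula on `[0,1]²`. -/
def IsCopula (C : ℝ → ℝ → ℝ) : Prop :=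
  (∀ u ∈ Set.Icc (0:ℝ) 1, ∀ v ∈ Set.Icc (0:ℝ) 1, C u v ∈ Set.Icc (0:ℝ) 1) ∧
  (∀ u ∈ Set.Icc (0:ℝ) 1, C u 0 = 0 ∧ C 0 u = 0 ∧ C u 1 = u ∧ C 1 u = u) ∧
  (∀ u₁ ∈ Set.Icc (0:ℝ) 1, ∀ u₂ ∈ Set.Icc (0:ℝ) 1, ∀ v₁ ∈ Set.Icc (0:ℝ) 1,
    ∀ v₂ ∈ Set.Icc (0:ℝ) 1, u₁ ≤ u₂ → v₁ ≤ v₂ →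
    0 ≤ C u₂ v₂ - C u₁ v₂ - C u₂ v₁ + C u₁ v₁)

/-- `𝒞(P,Q)`: the set of copulas lying pointwise between `P` and `Q` on `[0,1]²`. -/
def Cset (P Q : ℝ → ℝ → ℝ) : Set (ℝ → ℝ → ℝ) :=
  {C | IsCopula C ∧ ∀ u ∈ Set.Icc (0:ℝ) 1, ∀ v ∈ Set.Icc (0:ℝ) 1,
    P u v ≤ C u v ∧ C u v ≤ Q u v}

/-- `(P,Q)` is a coherent imprecise copula. -/
def CoherentImprecise (P Q : ℝ → ℝ → ℝ) : Prop :=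
  IsQuasiCopula P ∧ IsQuasiCopula Q ∧
  (∀ u ∈ Set.Icc (0:ℝ) 1, ∀ v ∈ Set.Icc (0:ℝ) 1, P u v ≤ Q u v) ∧
  (Cset P Q).Nonempty ∧
  (∀ u ∈ Set.Icc (0:ℝ) 1, ∀ v ∈ Set.Icc (0:ℝ) 1,
    P u v = sInf ((fun C => C u v) '' Cset P Q) ∧
    Q u v = sSup ((fun C => C u v) '' Cset P Q))

/-- `𝔇(A,B)`: the set of bivariate distributions with margins `FX`, `FY`
lying pointwise between `A` and `B`. -/
def Dset (FX FY : EReal → ℝ) (A B : EReal × EReal → ℝ) : Set (EReal × EReal → ℝ) :=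
  {F | IsDist F ∧ HasMargins F FX FY ∧ ∀ p, A p ≤ F p ∧ F p ≤ B p}

/-- The pointwise infimum of a set of bivariate functions. -/
def pinf (S : Set (EReal × EReal → ℝ)) : EReal × EReal → ℝ :=
  fun p => sInf ((fun F => F p) '' S)

/-- The pointwise supremum of a set of bivariate functions. -/
def psup (S : Set (EReal × EReal → ℝ)) : EReal × EReal → ℝ :=
  fun p => sSup ((fun F => F p) '' S)

/-- `S` is a coherent restricted bivariate `p`-box with margins `FX`, `FY`. -/
def CoherentPBox (FX FY : EReal → ℝ) (S : Set (EReal × EReal → ℝ)) : Prop :=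
  S.Nonempty ∧ (∀ F ∈ S, IsDist F ∧ HasMargins F FX FY) ∧
  S = Dset FX FY (pinf S) (psup S) ∧
  (∀ p, pinf S p = pinf (Dset FX FY (pinf S) (psup S)) p) ∧
  (∀ p, psup S p = psup (Dset FX FY (pinf S) (psup S)) p)

/-- A mesh `Δ = δ_x × δ_y`. -/
structure Mesh where
  sx : Finset EReal
  sy : Finset EReal
  botx : ⊥ ∈ sx
  topx : ⊤ ∈ sx
  boty : ⊥ ∈ sy
  topy : ⊤ ∈ sy
  posx : ∃ a ∈ sx, 0 < a ∧ a ≠ ⊤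
  negx : ∃ a ∈ sx, a < 0 ∧ a ≠ ⊥
  posy : ∃ a ∈ sy, 0 < a ∧ a ≠ ⊤
  negy : ∃ a ∈ sy, a < 0 ∧ a ≠ ⊥

/-- A discrete bivariate quasi-distribution on the mesh `Δ`. -/
def DiscQuasiDist (Δ : Mesh) (F : EReal × EReal → ℝ) : Prop :=
  (∀ x ∈ Δ.sx, ∀ y ∈ Δ.sy, F (x, y) ∈ Set.Icc (0:ℝ) 1) ∧
  (∀ x ∈ Δ.sx, F (x, ⊥) = 0) ∧ (∀ y ∈ Δ.sy, F (⊥, y) = 0) ∧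
  F (⊤, ⊤) = 1 ∧
  (∀ a₁ ∈ Δ.sx, ∀ a₂ ∈ Δ.sx, ∀ b₁ ∈ Δ.sy, ∀ b₂ ∈ Δ.sy, a₁ ≤ a₂ → b₁ ≤ b₂ →
    (IsInfinite a₁ ∨ IsInfinite a₂ ∨ IsInfinite b₁ ∨ IsInfinite b₂) →
    0 ≤ vol F a₁ a₂ b₁ b₂)

/-- A discrete bivariate distribution on the mesh `Δ`. -/
def DiscDist (Δ : Mesh) (F : EReal × EReal → ℝ) : Prop :=
  (∀ x ∈ Δ.sx, ∀ y ∈ Δ.sy, F (x, y) ∈ Set.Icc (0:ℝ) 1) ∧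
  (∀ x ∈ Δ.sx, F (x, ⊥) = 0) ∧ (∀ y ∈ Δ.sy, F (⊥, y) = 0) ∧
  F (⊤, ⊤) = 1 ∧
  (∀ a₁ ∈ Δ.sx, ∀ a₂ ∈ Δ.sx, ∀ b₁ ∈ Δ.sy, ∀ b₂ ∈ Δ.sy, a₁ ≤ a₂ → b₁ ≤ b₂ →
    0 ≤ vol F a₁ a₂ b₁ b₂)

/-- All rectangles of the union have their corners in the mesh `Δ`. -/
def inMeshU (Δ : Mesh) (U : List Rect) : Prop :=
  ∀ R ∈ U, R.x1 ∈ Δ.sx ∧ R.x2 ∈ Δ.sx ∧ R.y1 ∈ Δ.sy ∧ R.y2 ∈ Δ.sy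

/-- The reflection `A^δ(x,y) = F_Y(y) − A(−x,y)` of `A` having second margin `FY`. -/
def reflectFun (FY : EReal → ℝ) (A : EReal × EReal → ℝ) : EReal × EReal → ℝ :=
  fun p => FY p.2 - A (-p.1, p.2)

end
/-- Volume inequalities and margins pass from all members of `S` to any function `G` that inherits
constant values and two-point inequalities from `S`. -/
theorem isQuasiDist_of_inherits {FX FY : EReal → ℝ} {S : Set (EReal × EReal → ℝ)}
    (hS : ∀ F ∈ S, IsQuasiDist F ∧ HasMargins F FX FY) {G : EReal × EReal → ℝ}
    (hrange : ∀ p, G p ∈ Set.Icc (0 : ℝ) 1)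
    (hconst : ∀ p c, (∀ F ∈ S, F p = c) → G p = c)
    (hle : ∀ p q c, (∀ F ∈ S, F p ≤ F q + c) → G p ≤ G q + c) :
    IsQuasiDist G ∧ HasMargins G FX FY := by
  have hx0 : ∀ x, G (x, ⊥) = 0 := fun x => hconst _ _ fun F hF => (hS F hF).1.2.1 x
  have hy0 : ∀ y, G (⊥, y) = 0 := fun y => hconst _ _ fun F hF => (hS F hF).1.2.2.1 y
  have hX : ∀ x, G (x, ⊤) = FX x := fun x => hconst _ _ fun F hF => (hS F hF).2.1 x
  have hY : ∀ y, G (⊤, y) = FY y := fun y => hconst _ _ fun F hF => (hS F hF).2.2 y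
  refine ⟨⟨hrange, hx0, hy0, hconst _ _ fun F hF => (hS F hF).1.2.2.2.1, ?_⟩, hX, hY⟩
  intro a₁ a₂ b₁ b₂ ha hb h
  have hvol : ∀ F ∈ S, 0 ≤ vol F a₁ a₂ b₁ b₂ :=
    fun F hF => (hS F hF).1.2.2.2.2 a₁ a₂ b₁ b₂ ha hb h
  unfold vol at hvol ⊢
  rcases h with (rfl | rfl) | (rfl | rfl) | (rfl | rfl) | (rfl | rfl)
  · have := hle (a₂, b₁) (a₂, b₂) 0 fun F hF => by
      linarith [hvol F hF, (hS F hF).1.2.2.1 b₁, (hS F hF).1.2.2.1 b₂]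
    linarith [hy0 b₁, hy0 b₂]
  · obtain rfl := top_le_iff.mp ha
    linarith
  · obtain rfl := le_bot_iff.mp ha
    linarith
  · have := hle (a₁, b₂) (a₁, b₁) (FY b₂ - FY b₁) fun F hF => by
      linarith [hvol F hF, (hS F hF).2.2 b₁, (hS F hF).2.2 b₂]
    linarith [hY b₁, hY b₂]
  · have := hle (a₁, b₂) (a₂, b₂) 0 fun F hF => by
      linarith [hvol F hF, (hS F hF).1.2.1 a₁, (hS F hF).1.2.1 a₂]
    linarith [hx0 a₁, hx0 a₂]
  · obtain rfl := top_le_iff.mp hb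
    linarith
  · obtain rfl := le_bot_iff.mp hb
    linarith
  · have := hle (a₂, b₁) (a₁, b₁) (FX a₂ - FX a₁) fun F hF => by
      linarith [hvol F hF, (hS F hF).2.1 a₁, (hS F hF).2.1 a₂]
    linarith [hX a₁, hX a₂]

/-- **Lattice closure lemma.** The pointwise infimum and supremum of a nonempty set of
quasi-distributions with fixed margins `FX`, `FY` are again quasi-distributions with
margins `FX`, `FY`. -/
theorem lattice_closure (FX FY : EReal → ℝ)
    (S : Set (EReal × EReal → ℝ)) (hne : S.Nonempty)
    (hS : ∀ F ∈ S, IsQuasiDist F ∧ HasMargins F FX FY) :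
    (IsQuasiDist (pinf S) ∧ HasMargins (pinf S) FX FY) ∧
    (IsQuasiDist (psup S) ∧ HasMargins (psup S) FX FY) := by
  have hinf : ∀ p, IsGLB ((fun F => F p) '' S) (pinf S p) := fun p =>
    isGLB_csInf (hne.image _) ⟨0, by rintro _ ⟨F, hF, rfl⟩; exact ((hS F hF).1.1 p).1⟩
  have hsup : ∀ p, IsLUB ((fun F => F p) '' S) (psup S p) := fun p =>
    isLUB_csSup (hne.image _) ⟨1, by rintro _ ⟨F, hF, rfl⟩; exact ((hS F hF).1.1 p).2⟩
  have inf_le : ∀ p, ∀ F ∈ S, pinf S p ≤ F p := fun p F hF => (hinf p).1 ⟨F, hF, rfl⟩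
  have le_sup : ∀ p, ∀ F ∈ S, F p ≤ psup S p := fun p F hF => (hsup p).1 ⟨F, hF, rfl⟩
  have le_inf : ∀ p c, (∀ F ∈ S, c ≤ F p) → c ≤ pinf S p := fun p c h =>
    (hinf p).2 (by rintro _ ⟨F, hF, rfl⟩; exact h F hF)
  have sup_le : ∀ p c, (∀ F ∈ S, F p ≤ c) → psup S p ≤ c := fun p c h =>
    (hsup p).2 (by rintro _ ⟨F, hF, rfl⟩; exact h F hF)
  obtain ⟨F₀, hF₀⟩ := hne
  constructor
  · refine isQuasiDist_of_inherits hS (fun p => ⟨?_, ?_⟩) (fun p c h => ?_) fun p q c h => ?_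
    · exact le_inf p 0 fun F hF => ((hS F hF).1.1 p).1
    · exact (inf_le p F₀ hF₀).trans ((hS F₀ hF₀).1.1 p).2
    · exact le_antisymm ((inf_le p F₀ hF₀).trans_eq (h F₀ hF₀))
        (le_inf p c fun F hF => (h F hF).ge)
    · exact sub_le_iff_le_add.mp <| le_inf q _ fun F hF => by
        linarith [h F hF, inf_le p F hF]
  · refine isQuasiDist_of_inherits hS (fun p => ⟨?_, ?_⟩) (fun p c h => ?_) fun p q c h => ?_
    · exact ((hS F₀ hF₀).1.1 p).1.trans (le_sup p F₀ hF₀)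
    · exact sup_le p 1 fun F hF => ((hS F hF).1.1 p).2
    · exact le_antisymm (sup_le p c fun F hF => (h F hF).le)
        ((h F₀ hF₀).ge.trans (le_sup p F₀ hF₀))
    · exact sup_le p _ fun F hF => by linarith [h F hF, le_sup q F hF]
end

section
/- General imprecise Sklar theorem, part (i): Let ℱ be a nonempty set of bivariate distributions, let ℱ_{X,Y} = {(F_X,F_Y) : F ∈ ℱ} be the set of realized margin pairs, and for each pair F_{X,Y} = (F_X,F_Y) ∈ ℱ_{X,Y} let ℱ^{F_{X,Y}} = ℱ ∩ 𝔇^{F_X,F_Y}. Then for every F_{X,Y} ∈ ℱ_{X,Y} there exists a coherent imprecise copula (P_{F_{X,Y}}, Q_{F_{X,Y}}) such that inf_{F ∈ ℱ^{F_{X,Y}}} F (x,y) = P_{F_{X,Y}}(F_X(x), F_Y(y)) and sup_{F ∈ ℱ^{F_{X,Y}}} F (x,y) = Q_{F_{X,Y}}(F_X(x), F_Y(y)) for all (x,y) ∈ R̄². -/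
open scoped Classical

/-- `f` is nondecreasing with increments dominated by those of `φ`. -/
def IncrDominated {X : Type*} [LinearOrder X] (φ f : X → ℝ) : Prop :=
  ∀ x x', x ≤ x' → f x ≤ f x' ∧ f x' - f x ≤ φ x' - φ x

theorem IncrDominated.exists_lipschitz {X : Type*} [LinearOrder X] {φ f : X → ℝ}
    (h : IncrDominated φ f) :
    ∃ g : ℝ → ℝ, LipschitzWith 1 g ∧ ∀ x, g (φ x) = f x := by
  have key : ∀ x x', |f x - f x'| ≤ |φ x - φ x'| := by
    intro x x'
    rcases le_total x x' with hx | hx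
    · rw [abs_sub_comm, abs_sub_comm (φ x), abs_of_nonneg (by linarith [(h x x' hx).1])]
      exact (h x x' hx).2.trans (le_abs_self _)
    · rw [abs_of_nonneg (by linarith [(h x' x hx).1])]
      exact (h x' x hx).2.trans (le_abs_self _)
  have hinv : ∀ t : Set.range φ, ∃ x, φ x = t := fun t => t.2
  choose q hq using hinv
  let k : ℝ → ℝ := fun t => if ht : t ∈ Set.range φ then f (q ⟨t, ht⟩) else 0
  have hk : ∀ x, k (φ x) = f x := by
    intro x
    have hx : φ x ∈ Set.range φ := ⟨x, rfl⟩
    have h1 := key (q ⟨φ x, hx⟩) x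
    rw [hq, sub_self, abs_zero] at h1
    simp only [k, dif_pos hx]
    exact sub_eq_zero.mp (abs_nonpos_iff.mp h1)
  have hL : LipschitzOnWith 1 k (Set.range φ) := by
    refine LipschitzOnWith.of_dist_le_mul ?_
    rintro _ ⟨x, rfl⟩ _ ⟨x', rfl⟩
    simpa [Real.dist_eq, hk] using key x x'
  obtain ⟨g, hg, hgk⟩ := hL.extend_real
  exact ⟨g, hg, fun x => by rw [← hgk ⟨x, rfl⟩, hk]⟩

theorem MonotoneOn.closure_of_continuous {A : Set ℝ} {h : ℝ → ℝ} (hm : MonotoneOn h A)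
    (hc : Continuous h) : MonotoneOn h (closure A) := by
  intro s hs s' hs' hle
  rcases hle.eq_or_lt with rfl | hlt
  · exact le_rfl
  by_contra! hcon
  have hmem : (s, s') ∈ closure (A ×ˢ A) := by
    rw [closure_prod_eq]
    exact ⟨hs, hs'⟩
  have hopen : IsOpen {p : ℝ × ℝ | p.1 < p.2 ∧ h p.2 < h p.1} :=
    (isOpen_lt continuous_fst continuous_snd).inter
      (isOpen_lt (hc.comp continuous_snd) (hc.comp continuous_fst))
  obtain ⟨⟨t, t'⟩, ⟨h1, h2⟩, h3, h4⟩ := mem_closure_iff.mp hmem _ hopen ⟨hlt, hcon⟩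
  exact h2.not_ge (hm h3 h4 h1.le)

/-- The largest point of `K` below `u`. -/
noncomputable def lowerPt (K : Set ℝ) (u : ℝ) : ℝ := sSup (K ∩ Set.Iic u)

/-- The smallest point of `K` above `u`. -/
noncomputable def upperPt (K : Set ℝ) (u : ℝ) : ℝ := sInf (K ∩ Set.Ici u)

/-- The function which agrees with `g` on `K` and is linear on the gaps of `K`. -/
noncomputable def gapInterp (K : Set ℝ) (g : ℝ → ℝ) (u : ℝ) : ℝ :=
  g (lowerPt K u) + (u - lowerPt K u) / (upperPt K u - lowerPt K u) *
    (g (upperPt K u) - g (lowerPt K u))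

theorem lowerPt_mem {K : Set ℝ} (hK : IsClosed K) (h0 : (0 : ℝ) ∈ K) {u : ℝ} (hu : 0 ≤ u) :
    lowerPt K u ∈ K ∩ Set.Iic u :=
  (hK.inter isClosed_Iic).csSup_mem ⟨0, h0, hu⟩ ⟨u, fun _ h => h.2⟩

theorem upperPt_mem {K : Set ℝ} (hK : IsClosed K) (h1 : (1 : ℝ) ∈ K) {u : ℝ} (hu : u ≤ 1) :
    upperPt K u ∈ K ∩ Set.Ici u :=
  (hK.inter isClosed_Ici).csInf_mem ⟨1, h1, hu⟩ ⟨u, fun _ h => h.2⟩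

theorem le_lowerPt {K : Set ℝ} {u k : ℝ} (hk : k ∈ K) (h : k ≤ u) : k ≤ lowerPt K u :=
  le_csSup ⟨u, fun _ h => h.2⟩ ⟨hk, h⟩

theorem upperPt_le {K : Set ℝ} {u k : ℝ} (hk : k ∈ K) (h : u ≤ k) : upperPt K u ≤ k :=
  csInf_le ⟨u, fun _ h => h.2⟩ ⟨hk, h⟩

theorem gapInterp_of_mem {K : Set ℝ} {u : ℝ} (hu : u ∈ K) (g : ℝ → ℝ) :
    gapInterp K g u = g u := by
  have h1 : lowerPt K u = u :=
    le_antisymm (csSup_le ⟨u, hu, Set.self_mem_Iic⟩ fun _ h => h.2) (le_lowerPt hu le_rfl)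
  simp [gapInterp, h1]

theorem gapInterp_sub (K : Set ℝ) (f g : ℝ → ℝ) (u : ℝ) :
    gapInterp K (fun t => g t - f t) u = gapInterp K g u - gapInterp K f u := by
  simp only [gapInterp]
  ring

theorem gapInterp_linear {K : Set ℝ} (hK : IsClosed K) (h0 : (0 : ℝ) ∈ K) (h1 : (1 : ℝ) ∈ K)
    {g : ℝ → ℝ} {c : ℝ} (hg : ∀ k ∈ K, g k = c * k) {u : ℝ} (hu : u ∈ Set.Icc (0 : ℝ) 1) :
    gapInterp K g u = c * u := by
  obtain ⟨ha, hau⟩ := lowerPt_mem hK h0 hu.1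
  obtain ⟨hb, hbu⟩ := upperPt_mem hK h1 hu.2
  simp only [Set.mem_Iic, Set.mem_Ici] at hau hbu
  rw [gapInterp, hg _ ha, hg _ hb]
  rcases (hau.trans hbu).eq_or_lt with h | h
  · have : lowerPt K u = u := le_antisymm hau (h ▸ hbu)
    simp [this]
  · have : upperPt K u - lowerPt K u ≠ 0 := by linarith
    field_simp
    ring

theorem gapInterp_monotoneOn {K : Set ℝ} (hK : IsClosed K) (h0 : (0 : ℝ) ∈ K)
    (h1 : (1 : ℝ) ∈ K) {h : ℝ → ℝ} (hm : MonotoneOn h K) :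
    MonotoneOn (gapInterp K h) (Set.Icc 0 1) := by
  have bounds : ∀ u ∈ Set.Icc (0 : ℝ) 1,
      h (lowerPt K u) ≤ gapInterp K h u ∧ gapInterp K h u ≤ h (upperPt K u) := by
    intro u hu
    obtain ⟨ha, hau⟩ := lowerPt_mem hK h0 hu.1
    obtain ⟨hb, hbu⟩ := upperPt_mem hK h1 hu.2
    simp only [Set.mem_Iic, Set.mem_Ici] at hau hbu
    have hd := hm ha hb (hau.trans hbu)
    have hr0 : 0 ≤ (u - lowerPt K u) / (upperPt K u - lowerPt K u) :=
      div_nonneg (by linarith) (by linarith)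
    have hr1 : (u - lowerPt K u) / (upperPt K u - lowerPt K u) ≤ 1 :=
      div_le_one_of_le₀ (by linarith) (by linarith)
    rw [gapInterp]
    constructor <;> nlinarith
  intro u hu v hv huv
  obtain ⟨ha, hau⟩ := lowerPt_mem hK h0 hv.1
  obtain ⟨hb, hbu⟩ := upperPt_mem hK h1 hu.2
  obtain ⟨ha', hau'⟩ := lowerPt_mem hK h0 hu.1
  obtain ⟨hb', hbu'⟩ := upperPt_mem hK h1 hv.2
  simp only [Set.mem_Iic, Set.mem_Ici] at hau hbu hau' hbu'
  rcases le_or_gt (upperPt K u) v with h2 | h2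
  · exact (bounds u hu).2.trans ((hm hb ha (le_lowerPt hb h2)).trans (bounds v hv).1)
  · have hlow : lowerPt K u = lowerPt K v := by
      refine le_antisymm (le_lowerPt ha' (hau'.trans huv)) (le_lowerPt ha ?_)
      by_contra! h3
      linarith [upperPt_le ha h3.le]
    have hup : upperPt K u = upperPt K v :=
      le_antisymm (upperPt_le hb' (huv.trans hbu')) (upperPt_le hb h2.le)
    have hd := hm ha hb' (hau.trans hbu')
    simp only [gapInterp, hlow, hup]
    have : 0 ≤ upperPt K v - lowerPt K v := by linarith
    gcongr

/-- Functions dominated by a univariate distribution `φ` factor through `φ`, and the factors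
can be extended to `[0,1]` so that linear relations and order of increments are preserved. -/
theorem exists_increment_extension {X : Type*} [LinearOrder X] [BoundedOrder X] {φ : X → ℝ}
    (hbot : φ ⊥ = 0) (htop : φ ⊤ = 1) :
    ∃ E : (X → ℝ) → ℝ → ℝ,
      (∀ f, IncrDominated φ f → ∀ x, E f (φ x) = f x) ∧
      (∀ f c, IncrDominated φ f → (∀ x, f x = c * φ x) →
        ∀ u ∈ Set.Icc (0 : ℝ) 1, E f u = c * u) ∧
      (∀ f g, IncrDominated φ f → IncrDominated φ g → Monotone (fun x => g x - f x) →
        ∀ u ∈ Set.Icc (0 : ℝ) 1, ∀ v ∈ Set.Icc (0 : ℝ) 1, u ≤ v →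
          E f v - E f u ≤ E g v - E g u) := by
  have ext : ∀ f : X → ℝ, ∃ g : ℝ → ℝ,
      IncrDominated φ f → LipschitzWith 1 g ∧ ∀ x, g (φ x) = f x := by
    intro f
    by_cases hf : IncrDominated φ f
    · obtain ⟨g, hg⟩ := hf.exists_lipschitz
      exact ⟨g, fun _ => hg⟩
    · exact ⟨0, fun h => absurd h hf⟩
  choose e he using ext
  set K := closure (Set.range φ)
  have hK : IsClosed K := isClosed_closure
  have hmem : ∀ x, φ x ∈ K := fun x => subset_closure ⟨x, rfl⟩
  have h0 : (0 : ℝ) ∈ K := hbot ▸ hmem ⊥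
  have h1 : (1 : ℝ) ∈ K := htop ▸ hmem ⊤
  refine ⟨fun f => gapInterp K (e f), ?_, ?_, ?_⟩
  · intro f hf x
    exact (gapInterp_of_mem (hmem x) _).trans ((he f hf).2 x)
  · intro f c hf hfc u hu
    refine gapInterp_linear hK h0 h1 (fun k hk => ?_) hu
    have heq : Set.EqOn (e f) (fun t => c * t) (Set.range φ) := by
      rintro _ ⟨x, rfl⟩
      exact ((he f hf).2 x).trans (hfc x)
    exact heq.closure (he f hf).1.continuous (by fun_prop) hk
  · intro f g hf hg hfg u hu v hv huv
    have hm : MonotoneOn (fun t => e g t - e f t) (Set.range φ) := by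
      rintro _ ⟨x, rfl⟩ _ ⟨x', rfl⟩ hx
      simp only [(he f hf).2, (he g hg).2]
      rcases le_total x x' with hxx | hxx
      · exact hfg hxx
      · have := hf x' x hxx
        have := hg x' x hxx
        linarith
    have := gapInterp_monotoneOn hK h0 h1
      (hm.closure_of_continuous ((he g hg).1.continuous.sub (he f hf).1.continuous)) hu hv huv
    rw [gapInterp_sub, gapInterp_sub] at this
    linarith

/-- **Sklar's theorem** without right-continuity. -/
theorem IsDist.exists_copula {F : EReal × EReal → ℝ} (hF : IsDist F) :
    ∃ C, IsCopula C ∧ ∀ p : EReal × EReal, C (F (p.1, ⊤)) (F (⊤, p.2)) = F p := by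
  obtain ⟨-, hx0, h0y, h11, hvol⟩ := hF
  simp only [vol] at hvol
  obtain ⟨E, hE, hElin, hEinc⟩ :=
    exists_increment_extension (φ := fun x => F (x, ⊤)) (h0y ⊤) h11
  obtain ⟨E', hE', hElin', hEinc'⟩ :=
    exists_increment_extension (φ := fun y => F (⊤, y)) (hx0 ⊤) h11
  have m0 : (0 : ℝ) ∈ Set.Icc (0 : ℝ) 1 := by simp
  have m1 : (1 : ℝ) ∈ Set.Icc (0 : ℝ) 1 := by simp
  have hdom : ∀ y, IncrDominated (fun x => F (x, ⊤)) (fun x => F (x, y)) := by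
    intro y x x' hx
    have h1 := hvol x x' ⊥ y hx bot_le
    have h2 := hvol x x' y ⊤ hx le_top
    simp only [hx0] at h1
    constructor <;> linarith
  have hdiff : ∀ y y', y ≤ y' → Monotone (fun x => F (x, y') - F (x, y)) := by
    intro y y' hy x x' hx
    have := hvol x x' y y' hx hy
    simp only
    linarith
  let G : ℝ → EReal → ℝ := fun u y => E (fun x => F (x, y)) u
  have hG : ∀ x y, G (F (x, ⊤)) y = F (x, y) := fun x y => hE _ (hdom y) x
  have hG0 : ∀ y, G 0 y = 0 := fun y => by simpa only [h0y] using hG ⊥ y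
  have hG1 : ∀ y, G 1 y = F (⊤, y) := fun y => by simpa only [h11] using hG ⊤ y
  have hGinc : ∀ u ∈ Set.Icc (0 : ℝ) 1, ∀ v ∈ Set.Icc (0 : ℝ) 1, u ≤ v →
      Monotone (fun y => G v y - G u y) := fun u hu v hv huv y y' hy =>
    hEinc _ _ (hdom y) (hdom y') (hdiff y y' hy) u hu v hv huv
  have hGdom : ∀ u ∈ Set.Icc (0 : ℝ) 1, IncrDominated (fun y => F (⊤, y)) (G u) := by
    intro u hu y y' hy
    have h1 := hGinc 0 m0 u hu hu.1 hy
    have h2 := hGinc u hu 1 m1 hu.2 hy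
    simp only [hG0, hG1] at h1 h2
    constructor <;> linarith
  have hC2 : ∀ u₁ ∈ Set.Icc (0 : ℝ) 1, ∀ u₂ ∈ Set.Icc (0 : ℝ) 1, ∀ v₁ ∈ Set.Icc (0 : ℝ) 1,
      ∀ v₂ ∈ Set.Icc (0 : ℝ) 1, u₁ ≤ u₂ → v₁ ≤ v₂ →
      0 ≤ E' (G u₂) v₂ - E' (G u₁) v₂ - E' (G u₂) v₁ + E' (G u₁) v₁ := by
    intro u₁ hu₁ u₂ hu₂ v₁ hv₁ v₂ hv₂ hu hv
    linarith [hEinc' _ _ (hGdom u₁ hu₁) (hGdom u₂ hu₂) (hGinc u₁ hu₁ u₂ hu₂ hu)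
      v₁ hv₁ v₂ hv₂ hv]
  have hb : ∀ u ∈ Set.Icc (0 : ℝ) 1,
      E' (G u) 0 = 0 ∧ E' (G 0) u = 0 ∧ E' (G u) 1 = u ∧ E' (G 1) u = u := by
    intro u hu
    refine ⟨?_, ?_, ?_, ?_⟩
    · have h1 := hE' _ (hGdom u hu) ⊥
      have h2 := hElin _ 0 (hdom ⊥) (fun x => by simp [hx0]) u hu
      simp only [hx0 ⊤] at h1
      simpa [G, h2] using h1
    · simpa using hElin' _ 0 (hGdom 0 m0) (fun y => by simp [hG0]) u hu
    · have h1 := hE' _ (hGdom u hu) ⊤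
      have h2 := hElin _ 1 (hdom ⊤) (fun x => by simp) u hu
      simp only [h11] at h1
      simpa [G, h2] using h1
    · simpa using hElin' _ 1 (hGdom 1 m1) (fun y => by simp [hG1]) u hu
  refine ⟨fun u v => E' (G u) v, ⟨fun u hu v hv => ⟨?_, ?_⟩, hb, hC2⟩, ?_⟩
  · have := hC2 0 m0 u hu 0 m0 v hv hu.1 hv.1
    linarith [hb u hu, (hb v hv).2.1, (hb u hu).1, (hb 0 m0).1]
  · have := hC2 u hu 1 m1 0 m0 v hv hu.2 hv.1
    linarith [(hb v hv).2.2.2, (hb u hu).1, (hb 1 m1).1, hv.2]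
  · rintro ⟨x, y⟩
    have hx : F (x, ⊤) ∈ Set.Icc (0 : ℝ) 1 := by
      have h1 := hdom ⊤ ⊥ x bot_le
      have h2 := hdom ⊤ x ⊤ le_top
      simp only [h0y, h11] at h1 h2
      exact ⟨h1.1, h2.1⟩
    exact (hE' _ (hGdom _ hx) y).trans (hG x y)

theorem IsCopula.mono {C : ℝ → ℝ → ℝ} (hC : IsCopula C) {u u' v v' : ℝ}
    (hu : u ∈ Set.Icc (0 : ℝ) 1) (hu' : u' ∈ Set.Icc (0 : ℝ) 1) (hv : v ∈ Set.Icc (0 : ℝ) 1)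
    (hv' : v' ∈ Set.Icc (0 : ℝ) 1) (huu : u ≤ u') (hvv : v ≤ v') : C u v ≤ C u' v' := by
  have m0 : (0 : ℝ) ∈ Set.Icc (0 : ℝ) 1 := by simp
  have h1 := hC.2.2 u hu u' hu' 0 m0 v hv huu hv.1
  have h2 := hC.2.2 0 m0 u' hu' v hv v' hv' hu'.1 hvv
  linarith [(hC.2.1 u hu).1, (hC.2.1 u' hu').1, (hC.2.1 v hv).2.1, (hC.2.1 v' hv').2.1]

theorem IsCopula.le_add_abs {C : ℝ → ℝ → ℝ} (hC : IsCopula C) {u u' v v' : ℝ}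
    (hu : u ∈ Set.Icc (0 : ℝ) 1) (hu' : u' ∈ Set.Icc (0 : ℝ) 1) (hv : v ∈ Set.Icc (0 : ℝ) 1)
    (hv' : v' ∈ Set.Icc (0 : ℝ) 1) : C u v ≤ C u' v' + (|u - u'| + |v - v'|) := by
  have m1 : (1 : ℝ) ∈ Set.Icc (0 : ℝ) 1 := by simp
  have h1 : C u v ≤ C u' v + |u - u'| := by
    rcases le_total u u' with h | h
    · linarith [hC.mono hu hu' hv hv h le_rfl, abs_nonneg (u - u')]
    · linarith [hC.2.2 u' hu' u hu v hv 1 m1 h hv.2, (hC.2.1 u hu).2.2.1,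
        (hC.2.1 u' hu').2.2.1, le_abs_self (u - u')]
  have h2 : C u' v ≤ C u' v' + |v - v'| := by
    rcases le_total v v' with h | h
    · linarith [hC.mono hu' hu' hv hv' le_rfl h, abs_nonneg (v - v')]
    · linarith [hC.2.2 u' hu' 1 m1 v' hv' v hv hu'.2 h, (hC.2.1 v hv).2.2.2,
        (hC.2.1 v' hv').2.2.2, le_abs_self (v - v')]
  linarith

/-- `Q` is a quasi-copula if it inherits every constant value and every upper bound on
increments shared by all copulas of `S`. -/
theorem isQuasiCopula_of_le_transfer {S : Set (ℝ → ℝ → ℝ)} (hS : ∀ C ∈ S, IsCopula C)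
    {Q : ℝ → ℝ → ℝ}
    (hconst : ∀ u v c, (∀ C ∈ S, C u v = c) → Q u v = c)
    (htrans : ∀ u ∈ Set.Icc (0 : ℝ) 1, ∀ v ∈ Set.Icc (0 : ℝ) 1, ∀ u' ∈ Set.Icc (0 : ℝ) 1,
      ∀ v' ∈ Set.Icc (0 : ℝ) 1, ∀ d, (∀ C ∈ S, C u v ≤ C u' v' + d) → Q u v ≤ Q u' v' + d) :
    IsQuasiCopula Q := by
  have m0 : (0 : ℝ) ∈ Set.Icc (0 : ℝ) 1 := by simp
  have m1 : (1 : ℝ) ∈ Set.Icc (0 : ℝ) 1 := by simp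
  have hmono : ∀ u ∈ Set.Icc (0 : ℝ) 1, ∀ v ∈ Set.Icc (0 : ℝ) 1, ∀ u' ∈ Set.Icc (0 : ℝ) 1,
      ∀ v' ∈ Set.Icc (0 : ℝ) 1, u ≤ u' → v ≤ v' → Q u v ≤ Q u' v' := by
    intro u hu v hv u' hu' v' hv' h h'
    simpa using htrans u hu v hv u' hu' v' hv' 0
      fun C hC => by simpa using (hS C hC).mono hu hu' hv hv' h h'
  have hb : ∀ u ∈ Set.Icc (0 : ℝ) 1, Q u 0 = 0 ∧ Q 0 u = 0 ∧ Q u 1 = u ∧ Q 1 u = u :=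
    fun u hu => ⟨hconst _ _ _ fun C hC => ((hS C hC).2.1 u hu).1,
      hconst _ _ _ fun C hC => ((hS C hC).2.1 u hu).2.1,
      hconst _ _ _ fun C hC => ((hS C hC).2.1 u hu).2.2.1,
      hconst _ _ _ fun C hC => ((hS C hC).2.1 u hu).2.2.2⟩
  refine ⟨fun u hu v hv => ⟨?_, ?_⟩, hb, fun u hu u' hu' v hv h => ⟨?_, ?_⟩, ?_⟩
  · exact (hb u hu).1 ▸ hmono u hu 0 m0 u hu v hv le_rfl hv.1
  · exact (hb 1 m1).2.2.1 ▸ hmono u hu v hv 1 m1 1 m1 hu.2 hv.2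
  · exact hmono u hu v hv u' hu' v hv h le_rfl
  · exact hmono v hv u hu v hv u' hu' le_rfl h
  · intro u hu u' hu' v hv v' hv'
    have h1 := htrans u hu v hv u' hu' v' hv' _ fun C hC => (hS C hC).le_add_abs hu hu' hv hv'
    have h2 := htrans u' hu' v' hv' u hu v hv _ fun C hC => (hS C hC).le_add_abs hu' hu hv' hv
    rw [abs_sub_comm u', abs_sub_comm v'] at h2
    rw [abs_le]
    constructor <;> linarith

/-- The pointwise infimum and supremum of a nonempty set of copulas form a coherent
imprecise copula. -/
theorem coherentImprecise_of_copulas {S : Set (ℝ → ℝ → ℝ)} (hne : S.Nonempty)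
    (hS : ∀ C ∈ S, IsCopula C) :
    CoherentImprecise (fun u v => sInf ((fun C => C u v) '' S))
      (fun u v => sSup ((fun C => C u v) '' S)) := by
  have hbb : ∀ u ∈ Set.Icc (0 : ℝ) 1, ∀ v ∈ Set.Icc (0 : ℝ) 1,
      BddBelow ((fun C : ℝ → ℝ → ℝ => C u v) '' S) := by
    rintro u hu v hv
    refine ⟨0, ?_⟩
    rintro _ ⟨C, hC, rfl⟩
    exact ((hS C hC).1 u hu v hv).1
  have hba : ∀ u ∈ Set.Icc (0 : ℝ) 1, ∀ v ∈ Set.Icc (0 : ℝ) 1,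
      BddAbove ((fun C : ℝ → ℝ → ℝ => C u v) '' S) := by
    rintro u hu v hv
    refine ⟨1, ?_⟩
    rintro _ ⟨C, hC, rfl⟩
    exact ((hS C hC).1 u hu v hv).2
  have himg : ∀ u v c, (∀ C ∈ S, C u v = c) →
      (fun C : ℝ → ℝ → ℝ => C u v) '' S = {c} := by
    intro u v c h
    rw [Set.image_congr h, hne.image_const]
  have hmem : S ⊆ Cset (fun u v => sInf ((fun C => C u v) '' S))
      (fun u v => sSup ((fun C => C u v) '' S)) := fun C hC =>
    ⟨hS C hC, fun u hu v hv => ⟨csInf_le (hbb u hu v hv) ⟨C, hC, rfl⟩,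
      le_csSup (hba u hu v hv) ⟨C, hC, rfl⟩⟩⟩
  obtain ⟨C₀, hC₀⟩ := hne
  refine ⟨isQuasiCopula_of_le_transfer hS ?_ ?_, isQuasiCopula_of_le_transfer hS ?_ ?_,
    fun u hu v hv => ?_, ⟨C₀, hmem hC₀⟩, fun u hu v hv => ⟨?_, ?_⟩⟩
  · intro u v c h
    simp only [himg u v c h, csInf_singleton]
  · intro u hu v hv u' hu' v' hv' d h
    rw [← sub_le_iff_le_add]
    refine le_csInf ⟨_, C₀, hC₀, rfl⟩ ?_
    rintro _ ⟨C, hC, rfl⟩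
    have := csInf_le (hbb u hu v hv) ⟨C, hC, rfl⟩
    linarith [h C hC]
  · intro u v c h
    simp only [himg u v c h, csSup_singleton]
  · intro u hu v hv u' hu' v' hv' d h
    refine csSup_le ⟨_, C₀, hC₀, rfl⟩ ?_
    rintro _ ⟨C, hC, rfl⟩
    have := le_csSup (hba u' hu' v' hv') ⟨C, hC, rfl⟩
    linarith [h C hC]
  · exact ((hmem hC₀).2 u hu v hv).1.trans ((hmem hC₀).2 u hu v hv).2
  · refine le_antisymm (le_csInf ⟨_, C₀, hmem hC₀, rfl⟩ ?_) (csInf_le_csInf ⟨0, ?_⟩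
      ⟨_, C₀, hC₀, rfl⟩ (Set.image_mono hmem))
    · rintro _ ⟨C, hC, rfl⟩
      exact (hC.2 u hu v hv).1
    · rintro _ ⟨C, hC, rfl⟩
      exact (hC.1.1 u hu v hv).1
  · refine le_antisymm (csSup_le_csSup ⟨1, ?_⟩ ⟨_, C₀, hC₀, rfl⟩ (Set.image_mono hmem))
      (csSup_le ⟨_, C₀, hmem hC₀, rfl⟩ ?_)
    · rintro _ ⟨C, hC, rfl⟩
      exact (hC.1.1 u hu v hv).2
    · rintro _ ⟨C, hC, rfl⟩
      exact (hC.2 u hu v hv).2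

/-- **General imprecise Sklar theorem, part (i).** For every realized margin pair of a
nonempty set of bivariate distributions, the pointwise infimum and supremum of the
distributions with that margin pair are represented by a coherent imprecise copula. -/
theorem general_imprecise_sklar_i
    (Fam : Set (EReal × EReal → ℝ)) (hne : Fam.Nonempty)
    (hdist : ∀ F ∈ Fam, IsDist F) :
    ∀ F0 ∈ Fam, ∃ P Q : ℝ → ℝ → ℝ, CoherentImprecise P Q ∧
      ∀ p : EReal × EReal,
        pinf {F ∈ Fam | HasMargins F (fun x => F0 (x, ⊤)) (fun y => F0 (⊤, y))} p
          = P (F0 (p.1, ⊤)) (F0 (⊤, p.2)) ∧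
        psup {F ∈ Fam | HasMargins F (fun x => F0 (x, ⊤)) (fun y => F0 (⊤, y))} p
          = Q (F0 (p.1, ⊤)) (F0 (⊤, p.2)) := by
  intro F0 hF0
  set T := {F ∈ Fam | HasMargins F (fun x => F0 (x, ⊤)) (fun y => F0 (⊤, y))}
  let S : Set (ℝ → ℝ → ℝ) := {C | IsCopula C ∧ ∃ F ∈ T, ∀ p : EReal × EReal,
    C (F0 (p.1, ⊤)) (F0 (⊤, p.2)) = F p}
  have hT : ∀ F ∈ T, ∃ C ∈ S, ∀ p : EReal × EReal,
      C (F0 (p.1, ⊤)) (F0 (⊤, p.2)) = F p := by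
    intro F hF
    obtain ⟨C, hC, hCF⟩ := (hdist F hF.1).exists_copula
    simp only [hF.2.1, hF.2.2] at hCF
    exact ⟨C, ⟨hC, F, hF, hCF⟩, hCF⟩
  obtain ⟨C₀, hC₀, -⟩ := hT F0 ⟨hF0, fun _ => rfl, fun _ => rfl⟩
  refine ⟨_, _, coherentImprecise_of_copulas ⟨C₀, hC₀⟩ fun C hC => hC.1, fun p => ?_⟩
  have himg : (fun F : EReal × EReal → ℝ => F p) '' T =
      (fun C : ℝ → ℝ → ℝ => C (F0 (p.1, ⊤)) (F0 (⊤, p.2))) '' S := by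
    ext t
    constructor
    · rintro ⟨F, hF, rfl⟩
      obtain ⟨C, hC, hCF⟩ := hT F hF
      exact ⟨C, hC, hCF p⟩
    · rintro ⟨C, ⟨-, F, hF, hCF⟩, rfl⟩
      exact ⟨F, hF, (hCF p).symm⟩
  exact ⟨congrArg sInf himg, congrArg sSup himg⟩
end

section
/- Reflection lemma: Let δ : R̄² → R̄² be the reflection δ(x,y) = (−x, y), where −(+∞) = −∞ and −(−∞) = +∞. For a bivariate quasi-distribution A with margins F_X, F_Y define the reflected function A^δ(x,y) = F_Y(y) − A(−x,y). Then: (a) A^δ is a bivariate quasi-distribution with margins x ↦ 1 − F_X(−x) and F_Y; (b) if A ≤ B are quasi-distributions with the same margins F_X, F_Y, then B^δ ≤ A^δ, and for every R ∈ ℜ one has L^{(B^δ,A^δ)}(δ(R)) = L^{(A,B)}(R), where δ(R) denotes the image of R under δ; consequently P_O^{(B^δ,A^δ)}(δ(x)) = P_M^{(A,B)}(x) and P_M^{(B^δ,A^δ)}(δ(x)) = P_O^{(A,B)}(x) for every x ∈ R̄². -/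
open scoped Classical

lemma IsQuasiDist.reflectFun {A : EReal × EReal → ℝ} {FX FY : EReal → ℝ}
    (hA : IsQuasiDist A) (hm : HasMargins A FX FY) : IsQuasiDist (reflectFun FY A) := by
  obtain ⟨hI, hx, hy, h1, hv⟩ := hA
  refine ⟨fun p => ⟨?_, ?_⟩, fun x => ?_, fun y => ?_, ?_, fun a₁ a₂ b₁ b₂ ha hb h => ?_⟩
  · have := hv (-p.1) ⊤ ⊥ p.2 le_top bot_le (by simp [IsInfinite])
    simp only [vol, hx, hm.2] at this
    simp only [_root_.reflectFun]
    linarith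
  · have := (hI (-p.1, p.2)).1
    have := (hI (⊤, p.2)).2
    rw [hm.2] at this
    simp only [_root_.reflectFun]
    linarith
  · simp [_root_.reflectFun, ← hm.2, hx]
  · simp [_root_.reflectFun, hm.2]
  · simp [_root_.reflectFun, ← hm.2, hy, h1]
  · have := hv (-a₂) (-a₁) b₁ b₂ (EReal.neg_le_neg_iff.mpr ha) hb (by
      simp only [IsInfinite, EReal.neg_eq_bot_iff, EReal.neg_eq_top_iff] at h ⊢
      tauto)
    simp only [vol, _root_.reflectFun] at this ⊢
    linarith

lemma HasMargins.reflectFun {A : EReal × EReal → ℝ} {FX FY : EReal → ℝ}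
    (hA : IsQuasiDist A) (hm : HasMargins A FX FY) :
    HasMargins (reflectFun FY A) (fun x => 1 - FX (-x)) FY := by
  obtain ⟨-, -, hy, h1, -⟩ := hA
  refine ⟨fun x => ?_, fun y => ?_⟩
  · simp only [_root_.reflectFun, ← hm.1, ← hm.2, h1]
  · simp [_root_.reflectFun, hy]

/-- The reflection `δ(x,y) = (−x,y)` of `R̄²`. -/
noncomputable def reflectPt (p : EReal × EReal) : EReal × EReal := (-p.1, p.2)

lemma reflectPt_involutive : Function.Involutive reflectPt := fun p => by simp [reflectPt]

lemma Rect.reflect_involutive : Function.Involutive Rect.reflect := fun R => by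
  simp [Rect.reflect]

lemma Rect.mult_reflect (R : Rect) (p : EReal × EReal) :
    R.reflect.mult (reflectPt p) = -R.mult p := by
  simp only [Rect.mult, Rect.reflect, reflectPt, Prod.ext_iff, neg_inj]
  ring

lemma multU_reflect (U : List Rect) (p : EReal × EReal) :
    multU (U.map Rect.reflect) (reflectPt p) = -multU U p := by
  induction U with
  | nil => simp [multU]
  | cons R U ih =>
    simp only [multU, List.map_cons, List.sum_cons] at ih ⊢
    rw [ih, R.mult_reflect]
    ring

lemma Rect.inter_reflect (R : Rect) : R.reflect.inter = reflectPt ⁻¹' R.inter := by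
  ext p
  simp only [Rect.inter, Rect.reflect, reflectPt, Set.mem_prod, Set.mem_Ioo, Set.mem_preimage,
    EReal.neg_lt_comm, EReal.lt_neg_comm]
  tauto

lemma disjU.reflect {U : List Rect} (hU : disjU U) : disjU (U.map Rect.reflect) := by
  refine List.pairwise_map.mpr (List.Pairwise.imp (fun {R S} h => ?_) hU)
  rw [R.inter_reflect, S.inter_reflect]
  exact h.preimage _

lemma cornersU_reflect (U : List Rect) :
    cornersU (U.map Rect.reflect) = (cornersU U).image reflectPt := by
  ext p
  simp only [cornersU, List.mem_toFinset, List.mem_flatMap, List.mem_map, Finset.mem_image,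
    exists_exists_and_eq_and]
  constructor
  · rintro ⟨R, hR, hp⟩
    refine ⟨reflectPt p, ⟨R, hR, ?_⟩, reflectPt_involutive p⟩
    simp only [Rect.cornerList, Rect.reflect, List.mem_cons, List.not_mem_nil] at hp ⊢
    rcases hp with rfl | rfl | rfl | rfl | h <;> simp_all [reflectPt]
  · rintro ⟨q, ⟨R, hR, hq⟩, rfl⟩
    refine ⟨R, hR, ?_⟩
    simp only [Rect.cornerList, Rect.reflect, List.mem_cons, List.not_mem_nil] at hq ⊢
    rcases hq with rfl | rfl | rfl | rfl | h <;> simp_all [reflectPt]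

lemma Rect.sum_mult_eq_zero (R : Rect) (f : EReal → ℝ) (S : Finset (EReal × EReal))
    (hS : ∀ p ∈ R.cornerList, p ∈ S) : ∑ p ∈ S, f p.2 * (R.mult p : ℝ) = 0 := by
  simp only [Rect.cornerList, List.forall_mem_cons] at hS
  obtain ⟨h₁, h₂, h₃, h₄, -⟩ := hS
  simp only [Rect.mult, Int.cast_sub, Int.cast_add, Int.cast_ite, Int.cast_one, Int.cast_zero,
    mul_sub, mul_add, mul_ite, mul_one, mul_zero, Finset.sum_sub_distrib, Finset.sum_add_distrib,
    Finset.sum_ite_eq', h₁, h₂, h₃, h₄, if_true]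
  ring

lemma sum_multU_eq_zero (U : List Rect) (f : EReal → ℝ) (S : Finset (EReal × EReal))
    (hS : cornersU U ⊆ S) : ∑ p ∈ S, f p.2 * (multU U p : ℝ) = 0 := by
  induction U with
  | nil => simp [multU]
  | cons R U ih =>
    have hR : ∀ p ∈ R.cornerList, p ∈ S := fun p hp => hS (by simp [cornersU, hp])
    have hU : cornersU U ⊆ S := fun p hp => hS (by
      simp only [cornersU, List.mem_toFinset, List.flatMap_cons, List.mem_append] at hp ⊢
      exact Or.inr hp)
    have h : ∀ p, (multU (R :: U) p : ℝ) = R.mult p + multU U p := fun p => by simp [multU]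
    simp only [h, mul_add, Finset.sum_add_distrib, ih hU, R.sum_mult_eq_zero f S hR, add_zero]

lemma Lval_reflect (A B : EReal × EReal → ℝ) (FY : EReal → ℝ) (U : List Rect) :
    Lval (reflectFun FY B) (reflectFun FY A) (U.map Rect.reflect) = Lval A B U := by
  rw [Lval, cornersU_reflect, Finset.sum_image reflectPt_involutive.injective.injOn, Lval,
    ← sub_eq_zero, ← Finset.sum_sub_distrib, ← neg_eq_zero, ← Finset.sum_neg_distrib,
    ← sum_multU_eq_zero U FY _ subset_rfl]
  refine Finset.sum_congr rfl fun p _ => ?_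
  rw [multU_reflect]
  simp only [reflectFun, reflectPt, neg_neg, Int.cast_neg, Left.neg_pos_iff, Left.neg_neg_iff]
  rcases lt_trichotomy (multU U p) 0 with h | h | h
  · simp only [h, h.not_gt, if_true, if_false]
    ring
  · simp [h]
  · simp only [h, h.not_gt, if_true, if_false]
    ring

lemma PO_reflect (A B : EReal × EReal → ℝ) (FY : EReal → ℝ) (x : EReal × EReal) :
    PO (reflectFun FY B) (reflectFun FY A) (reflectPt x) = PM A B x := by
  let e : {U : List Rect // disjU U ∧ 0 < multU U x} →
      {U : List Rect // disjU U ∧ multU U (reflectPt x) < 0} := fun U =>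
    ⟨U.1.map Rect.reflect, U.2.1.reflect, by rw [multU_reflect]; exact neg_neg_of_pos U.2.2⟩
  have he : Function.Surjective e := fun V => by
    refine ⟨⟨V.1.map Rect.reflect, V.2.1.reflect, ?_⟩, Subtype.ext ?_⟩
    · have := multU_reflect V.1 (reflectPt x)
      rw [reflectPt_involutive x] at this
      rw [this]
      exact neg_pos.mpr V.2.2
    · simp [e, Rect.reflect_involutive.comp_self]
  refine (he.iInf_congr e fun U => ?_).symm
  simp only [e, Lval_reflect, multU_reflect, Int.cast_neg, neg_neg]

lemma PM_reflect (A B : EReal × EReal → ℝ) (FY : EReal → ℝ) (x : EReal × EReal) :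
    PM (reflectFun FY B) (reflectFun FY A) (reflectPt x) = PO A B x := by
  have h : ∀ C, reflectFun FY (reflectFun FY C) = C := fun C => by
    ext p
    simp [reflectFun]
  rw [← PO_reflect (reflectFun FY B) (reflectFun FY A) FY (reflectPt x), h, h,
    reflectPt_involutive x]

/-- **Reflection lemma.** The reflection `A^δ(x,y) = F_Y(y) − A(−x,y)` of a
quasi-distribution is a quasi-distribution with margins `x ↦ 1 − F_X(−x)` and `F_Y`;
reflection reverses the order and intertwines `L`, `P_O` and `P_M`. -/
theorem reflection_lemma (A : EReal × EReal → ℝ) (FX FY : EReal → ℝ)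
    (hA : IsQuasiDist A) (hmA : HasMargins A FX FY) :
    (IsQuasiDist (reflectFun FY A) ∧
      HasMargins (reflectFun FY A) (fun x => 1 - FX (-x)) FY) ∧
    (∀ B : EReal × EReal → ℝ, IsQuasiDist B → HasMargins B FX FY →
      (∀ p, A p ≤ B p) →
      (∀ p, reflectFun FY B p ≤ reflectFun FY A p) ∧
      (∀ U : List Rect, disjU U →
        Lval (reflectFun FY B) (reflectFun FY A) (U.map Rect.reflect) = Lval A B U) ∧
      (∀ x : EReal × EReal,
        PO (reflectFun FY B) (reflectFun FY A) (-x.1, x.2) = PM A B x ∧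
        PM (reflectFun FY B) (reflectFun FY A) (-x.1, x.2) = PO A B x)) := by
  exact ⟨⟨hA.reflectFun hmA, hmA.reflectFun hA⟩, fun B _ _ hAB =>
    ⟨fun p => sub_le_sub_left (hAB _) _, fun U _ => Lval_reflect A B FY U,
      fun x => ⟨PO_reflect A B FY x, PM_reflect A B FY x⟩⟩⟩
end

section
/- Lower bound for L against a 2-increasing majorant: Let A, F : R̄² → ℝ satisfy A ≤ F pointwise, and suppose V_F(R) ≥ 0 for every rectangle R ⊆ R̄². Then for every x ∈ R̄² and every R ∈ ℜ with m_R(x) < 0 one has L^{(A,F)}(R) ≥ (F(x) − A(x))·(−m_R(x)); consequently P_O^{(A,F)}(x) ≥ F(x) − A(x) for all x ∈ R̄². -/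
open scoped Classical

theorem Rect.sum_mul_mult (F : EReal × EReal → ℝ) (R : Rect) (S : Finset (EReal × EReal))
    (hS : ∀ p ∈ R.cornerList, p ∈ S) :
    ∑ p ∈ S, F p * (R.mult p : ℝ) = vol F R.x1 R.x2 R.y1 R.y2 := by
  simp only [Rect.cornerList, List.mem_cons, List.not_mem_nil, or_false, forall_eq_or_imp,
    forall_eq] at hS
  obtain ⟨h₁, h₂, h₃, h₄⟩ := hS
  simp only [Rect.mult, Int.cast_add, Int.cast_sub, Int.cast_ite, Int.cast_one, Int.cast_zero,
    mul_add, mul_sub, mul_ite, mul_one, mul_zero, Finset.sum_add_distrib, Finset.sum_sub_distrib,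
    Finset.sum_ite_eq', h₁, h₂, h₃, h₄, if_true, vol]
  ring

theorem sum_mul_multU (F : EReal × EReal → ℝ) (U : List Rect) (S : Finset (EReal × EReal))
    (hS : ∀ R ∈ U, ∀ p ∈ R.cornerList, p ∈ S) :
    ∑ p ∈ S, F p * (multU U p : ℝ) = (U.map fun R => vol F R.x1 R.x2 R.y1 R.y2).sum := by
  induction U with
  | nil => simp [multU]
  | cons R U ih =>
    have hU : ∀ p, multU (R :: U) p = R.mult p + multU U p := fun p => by simp [multU]
    simp only [hU, Int.cast_add, mul_add, Finset.sum_add_distrib, List.map_cons, List.sum_cons]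
    rw [R.sum_mul_mult F S (hS R (by simp)), ih fun T hT => hS T (by simp [hT])]

theorem mem_cornersU {U : List Rect} {p : EReal × EReal} :
    p ∈ cornersU U ↔ ∃ R ∈ U, p ∈ R.cornerList := by
  simp [cornersU]

theorem mem_cornersU_of_multU_ne_zero {U : List Rect} {p : EReal × EReal} (h : multU U p ≠ 0) :
    p ∈ cornersU U := by
  contrapose! h
  refine List.sum_eq_zero fun m hm => ?_
  obtain ⟨R, hR, rfl⟩ := List.mem_map.mp hm
  have hp : p ∉ R.cornerList := fun hp => h (mem_cornersU.mpr ⟨R, hR, hp⟩)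
  simp only [Rect.cornerList, List.mem_cons, List.not_mem_nil, or_false, not_or] at hp
  simp [Rect.mult, hp]

/-- The value of `L` is the volume plus the nonnegative gaps `F - A`, weighted by the negative
parts of the multiplicities. -/
theorem Lval_eq (A F : EReal × EReal → ℝ) (U : List Rect) :
    Lval A F U = (U.map fun R => vol F R.x1 R.x2 R.y1 R.y2).sum +
      ∑ p ∈ cornersU U, if multU U p < 0 then (F p - A p) * (-(multU U p : ℝ)) else 0 := by
  rw [← sum_mul_multU F U (cornersU U) fun R hR p hp => mem_cornersU.mpr ⟨R, hR, hp⟩,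
    ← Finset.sum_add_distrib, Lval]
  refine Finset.sum_congr rfl fun p _ => ?_
  rcases lt_trichotomy (multU U p) 0 with h | h | h
  · rw [if_neg h.not_gt, if_pos h, if_pos h]
    ring
  · simp [h]
  · rw [if_pos h, if_neg h.not_gt, add_zero]

theorem mul_neg_multU_le_Lval {A F : EReal × EReal → ℝ} (hAF : ∀ p, A p ≤ F p)
    (hF : ∀ a₁ a₂ b₁ b₂ : EReal, a₁ ≤ a₂ → b₁ ≤ b₂ → 0 ≤ vol F a₁ a₂ b₁ b₂)
    {x : EReal × EReal} {U : List Rect} (hx : multU U x < 0) :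
    (F x - A x) * (-(multU U x : ℝ)) ≤ Lval A F U := by
  have hvol : 0 ≤ (U.map fun R => vol F R.x1 R.x2 R.y1 R.y2).sum := by
    refine List.sum_nonneg fun v hv => ?_
    obtain ⟨R, -, rfl⟩ := List.mem_map.mp hv
    exact hF _ _ _ _ R.hx.le R.hy.le
  have hgap : ∀ p ∈ cornersU U,
      0 ≤ if multU U p < 0 then (F p - A p) * (-(multU U p : ℝ)) else 0 := by
    intro p _
    split_ifs with h
    · exact mul_nonneg (sub_nonneg.mpr (hAF p)) (neg_nonneg.mpr (by exact_mod_cast h.le))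
    · exact le_rfl
  have hle := Finset.single_le_sum hgap (mem_cornersU_of_multU_ne_zero hx.ne)
  rw [if_pos hx] at hle
  rw [Lval_eq]
  linarith

/-- **Lower bound for `L` against a 2-increasing majorant.** If `A ≤ F` and `F` is
2-increasing, then `L^{(A,F)}(R) ≥ (F(x) − A(x))·(−m_R(x))` whenever `m_R(x) < 0`;
consequently `P_O^{(A,F)}(x) ≥ F(x) − A(x)`. -/
theorem L_lower_bound (A F : EReal × EReal → ℝ)
    (hAF : ∀ p, A p ≤ F p)
    (hF : ∀ a₁ a₂ b₁ b₂ : EReal, a₁ ≤ a₂ → b₁ ≤ b₂ → 0 ≤ vol F a₁ a₂ b₁ b₂) :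
    (∀ x : EReal × EReal, ∀ U : List Rect, disjU U → multU U x < 0 →
      (F x - A x) * (-(multU U x : ℝ)) ≤ Lval A F U) ∧
    (∀ x : EReal × EReal, ((F x - A x : ℝ) : EReal) ≤ PO A F x) := by
  refine ⟨fun x U _ hx => mul_neg_multU_le_Lval hAF hF hx, fun x => le_iInf fun U => ?_⟩
  have hpos : (0 : ℝ) < -(multU U.1 x : ℝ) := neg_pos.mpr (by exact_mod_cast U.2.2)
  exact EReal.coe_le_coe_iff.mpr
    ((le_div_iff₀ hpos).mpr (mul_neg_multU_le_Lval hAF hF U.2.2))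
end
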